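/- arXiv:1902.04774 — 3 statements merged into one kernel-verified Lean document; each statement's English description precedes it below -/
import Mathlib

section
/- Fix integers n, m ≥ 1, T ≥ 2, a doubly stochastic matrix W ∈ ℝ^{n×n} with nonnegative entries and σ := ‖W − (1/n)𝟏𝟏ᵀ‖ < 1, and data h_i(t) ∈ ℝ^m, z_i(t) ∈ ℝ with ‖h_i(t)‖² ≤ α (α > 0) for all i ∈ {1,…,n}, t ∈ {1,…,T}. Let y* ∈ ℝ^m be a minimizer over ℝ^m of the network-wide loss ∑_{t=1}^T ∑_{j=1}^n θ_{j,t}(·), and assume |h_i(t)ᵀy* − z_i(t)| ≤ θ* (θ* > 0) for all i, t. Run DOLR-FIF with β = 3/4, i.e. x_i(t+1) = ∑_{j=1}^n W_{ij}·(x_j(t) − (1/(α T^{3/4}))·h_j(t)(h_j(t)ᵀx_j(t) − z_j(t))). Then for every node i: ∑_{t=1}^{T} ∑_{j=1}^{n} θ_{j,t}(x_i(t)) − ∑_{t=1}^{T} ∑_{j=1}^{n} θ_{j,t}(y*) ≤ ((1/2)·n·(θ*)² + 2·C₆)·T^{3/4}, where C₆ = (α/2)∑_i ‖x_i(1) − y*‖²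 + (1/(2α))(C₁ + C₂) + 6αn(C₃² + C₄² + C₅²), and (with β = 3/4) C₁ = (2^{3/4}/(2^{3/4}−1))·α²·∑_i ‖x_i(1) − y*‖², C₂ = (2^{3/4}/(2^{3/4}−1))·α·n·(θ*)², C₃ = ∑_i ‖x_i(1) − x̄(1)‖ + √n·(σ/(1−σ))·∑_i ‖x_i(1)‖, C₄ = n·(σ/(α(1−σ)))·√C₁, C₅ = n·(σ/(α(1−σ)))·√C₂. -/
open MeasureTheory ProbabilityTheory Finset
open scoped RealInnerProductSpace Pointwise

noncomputable section

/-- `ℝ^m` with the Euclidean norm. -/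
abbrev Euc (m : ℕ) := EuclideanSpace ℝ (Fin m)

/-- The square loss `θ(y) = (1/2)(hᵀy − z)²`. -/
def sqLoss {m : ℕ} (h : Euc m) (z : ℝ) (y : Euc m) : ℝ := (1/2) * (⟪h, y⟫ - z)^2

/-- The gradient `h (hᵀy − z)` of the square loss at `y`. -/
def sqLossGrad {m : ℕ} (h : Euc m) (z : ℝ) (y : Euc m) : Euc m := (⟪h, y⟫ - z) • h

/-- A matrix is doubly stochastic: nonnegative entries, every row and column sums to 1. -/
def DoublyStochastic {n : ℕ} (W : Matrix (Fin n) (Fin n) ℝ) : Prop :=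
  (∀ i j, 0 ≤ W i j) ∧ (∀ i, ∑ j, W i j = 1) ∧ (∀ j, ∑ i, W i j = 1)

/-- Operator norm of a matrix, induced by the Euclidean norm on `ℝ^n`. -/
def matOpNorm {n : ℕ} (M : Matrix (Fin n) (Fin n) ℝ) : ℝ :=
  ‖LinearMap.toContinuousLinearMap (Matrix.toEuclideanLin M)‖

/-- The averaging matrix `(1/n) 𝟏𝟏ᵀ`. -/
def avgMatrix (n : ℕ) : Matrix (Fin n) (Fin n) ℝ := Matrix.of fun _ _ => (n : ℝ)⁻¹

/-- Telescoping a one-step decrease of a nonnegative potential. -/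
theorem sum_Icc_le_of_add_le {a b : ℕ → ℝ} {T : ℕ} (ha : ∀ t, 0 ≤ a t)
    (hab : ∀ t ∈ Finset.Icc 1 T, a (t + 1) + b t ≤ a t) :
    ∑ t ∈ Finset.Icc 1 T, b t ≤ a 1 := by
  have key : ∀ S ≤ T, a (S + 1) + ∑ t ∈ Finset.Icc 1 S, b t ≤ a 1 := by
    intro S
    induction S with
    | zero => simp
    | succ S ih =>
      intro hS
      rw [Finset.sum_Icc_succ_top (by omega)]
      have h1 := ih (by omega)
      have h2 := hab (S + 1) (Finset.mem_Icc.2 ⟨by omega, hS⟩)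
      linarith
  linarith [key T le_rfl, ha (T + 1)]

namespace DoublyStochastic

variable {n m : ℕ} {W : Matrix (Fin n) (Fin n) ℝ}

/-- Mixing with a doubly stochastic matrix does not increase the total squared distance to a
point. -/
theorem sum_norm_sub_sq_le (hW : DoublyStochastic W) (v : Fin n → Euc m) (c : Euc m) :
    ∑ i, ‖∑ j, W i j • v j - c‖ ^ 2 ≤ ∑ j, ‖v j - c‖ ^ 2 := by
  obtain ⟨hpos, hrow, hcol⟩ := hW
  have hstep : ∀ i, ‖∑ j, W i j • v j - c‖ ^ 2 ≤ ∑ j, W i j * ‖v j - c‖ ^ 2 := by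
    intro i
    have heq : ∑ j, W i j • v j - c = ∑ j, W i j • (v j - c) := by
      simp only [smul_sub, Finset.sum_sub_distrib, ← Finset.sum_smul, hrow, one_smul]
    have hle : ‖∑ j, W i j • (v j - c)‖ ≤ ∑ j, W i j * ‖v j - c‖ := by
      refine (norm_sum_le _ _).trans (Finset.sum_le_sum fun j _ => ?_)
      rw [norm_smul, Real.norm_of_nonneg (hpos i j)]
    rw [heq]
    exact (pow_le_pow_left₀ (norm_nonneg _) hle 2).trans
      (Real.pow_arith_mean_le_arith_mean_pow _ _ _ (fun j _ => hpos i j) (hrow i)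
        (fun j _ => norm_nonneg _) 2)
  refine (Finset.sum_le_sum fun i _ => hstep i).trans_eq ?_
  rw [Finset.sum_comm]
  simp only [← Finset.sum_mul, hcol, one_mul]

/-- Mixing with a doubly stochastic matrix preserves the sum. -/
theorem sum_mix (hW : DoublyStochastic W) (v : Fin n → Euc m) :
    ∑ i, ∑ j, W i j • v j = ∑ j, v j := by
  rw [Finset.sum_comm]
  simp only [← Finset.sum_smul, hW.2.2, one_smul]

end DoublyStochastic

/-- The operator norm bounds the action of a matrix on a family of vectors. -/
theorem sum_norm_mix_sq_le {n m : ℕ} (M : Matrix (Fin n) (Fin n) ℝ) (w : Fin n → Euc m) :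
    ∑ i, ‖∑ j, M i j • w j‖ ^ 2 ≤ matOpNorm M ^ 2 * ∑ j, ‖w j‖ ^ 2 := by
  have hcoord : ∀ k, ∑ i, (∑ j, M i j * w j k) ^ 2 ≤ matOpNorm M ^ 2 * ∑ j, (w j k) ^ 2 := by
    intro k
    have hle := (LinearMap.toContinuousLinearMap (Matrix.toEuclideanLin M)).le_opNorm
      (WithLp.toLp 2 fun j => w j k)
    have hsq := pow_le_pow_left₀ (norm_nonneg _) hle 2
    rw [mul_pow, EuclideanSpace.real_norm_sq_eq, EuclideanSpace.real_norm_sq_eq] at hsq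
    simpa [matOpNorm, Matrix.mulVec, dotProduct] using hsq
  simp only [EuclideanSpace.real_norm_sq_eq]
  rw [Finset.sum_comm, Finset.sum_comm (f := fun j k => (w j k) ^ 2), Finset.mul_sum]
  refine Finset.sum_le_sum fun k _ => ?_
  simpa using hcoord k

/-- One mixing step contracts the spread around the average. -/
theorem DoublyStochastic.sum_norm_sub_avg_sq_le {n m : ℕ} {W : Matrix (Fin n) (Fin n) ℝ}
    (hn : n ≠ 0) (hW : DoublyStochastic W) (v : Fin n → Euc m) (c : Euc m) :
    ∑ i, ‖∑ j, W i j • v j - (n : ℝ)⁻¹ • ∑ k, ∑ j, W k j • v j‖ ^ 2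
      ≤ matOpNorm (W - avgMatrix n) ^ 2 * ∑ j, ‖v j - c‖ ^ 2 := by
  refine le_trans (le_of_eq (Finset.sum_congr rfl fun i _ => ?_))
    (sum_norm_mix_sq_le (W - avgMatrix n) fun j => v j - c)
  rw [hW.sum_mix]
  have hn' : (n : ℝ) ≠ 0 := by exact_mod_cast hn
  congr 2
  simp only [avgMatrix, Matrix.sub_apply, Matrix.of_apply, smul_sub, sub_smul,
    Finset.sum_sub_distrib, ← Finset.sum_smul, hW.2.1, Finset.smul_sum]
  simp [hn', ← Nat.cast_smul_eq_nsmul ℝ]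

/-- The squared distance to the comparator after a gradient step on the square loss. -/
theorem norm_sub_smul_sqLossGrad_sub_sq_le {m : ℕ} {h x y : Euc m} {z α η : ℝ}
    (hh : ‖h‖ ^ 2 ≤ α) :
    ‖x - η • sqLossGrad h z x - y‖ ^ 2 ≤ ‖x - y‖ ^ 2
      - 2 * η * ((⟪h, x⟫ - z) * ((⟪h, x⟫ - z) - (⟪h, y⟫ - z)))
      + η ^ 2 * (α * (⟪h, x⟫ - z) ^ 2) := by
  have hsub : x - η • sqLossGrad h z x - y = (x - y) - (η * (⟪h, x⟫ - z)) • h := by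
    rw [sqLossGrad, smul_smul]; abel
  rw [hsub, norm_sub_sq_real, inner_smul_right, real_inner_comm h (x - y), inner_sub_right, norm_smul,
    mul_pow, Real.norm_eq_abs, sq_abs]
  have := mul_le_mul_of_nonneg_left hh (sq_nonneg (η * (⟪h, x⟫ - z)))
  nlinarith

theorem norm_sqLossGrad_sq_le {m : ℕ} {h x : Euc m} {z α : ℝ} (hh : ‖h‖ ^ 2 ≤ α) :
    ‖sqLossGrad h z x‖ ^ 2 ≤ α * (⟪h, x⟫ - z) ^ 2 := by
  rw [sqLossGrad, norm_smul, mul_pow, Real.norm_eq_abs, sq_abs, mul_comm]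
  exact mul_le_mul_of_nonneg_right hh (sq_nonneg _)

/-- Young's inequality for a damped perturbation. -/
theorem sq_mul_norm_sub_sq_le {m : ℕ} {σ : ℝ} (hσ0 : 0 ≤ σ) (hσ : σ < 1) (a b : Euc m) :
    σ ^ 2 * ‖a - b‖ ^ 2 ≤ σ * ‖a‖ ^ 2 + σ ^ 2 / (1 - σ) * ‖b‖ ^ 2 := by
  have h1 : 0 < 1 - σ := by linarith
  have hle : ‖a - b‖ ^ 2 ≤ (‖a‖ + ‖b‖) ^ 2 :=
    pow_le_pow_left₀ (norm_nonneg _) (norm_sub_le a b) 2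
  refine (mul_le_mul_of_nonneg_left hle (sq_nonneg σ)).trans ?_
  rw [← sub_nonneg]
  have : σ * ‖a‖ ^ 2 + σ ^ 2 / (1 - σ) * ‖b‖ ^ 2 - σ ^ 2 * (‖a‖ + ‖b‖) ^ 2
      = σ / (1 - σ) * ((1 - σ) * ‖a‖ - σ * ‖b‖) ^ 2 := by
    field_simp; ring
  rw [this]; positivity

/-- Comparing the square loss at two points with a weight `q`. -/
theorem sqLoss_le_add {m : ℕ} {h x y : Euc m} {z α q : ℝ} (hh : ‖h‖ ^ 2 ≤ α) (hq : 0 < q) :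
    sqLoss h z y ≤ (1 + q⁻¹) * (1 / 2 * (⟪h, x⟫ - z) ^ 2)
      + (1 + q) * (1 / 2 * (α * ‖y - x‖ ^ 2)) := by
  have hin : ⟪h, y - x⟫ ^ 2 ≤ α * ‖y - x‖ ^ 2 := by
    rw [← sq_abs]
    refine (pow_le_pow_left₀ (abs_nonneg _) (abs_real_inner_le_norm h (y - x)) 2).trans ?_
    rw [mul_pow]
    exact mul_le_mul_of_nonneg_right hh (sq_nonneg _)
  have hsplit : ⟪h, y⟫ - z = (⟪h, x⟫ - z) + ⟪h, y - x⟫ := by rw [inner_sub_right]; ring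
  rw [sqLoss, hsplit]
  generalize ⟪h, x⟫ - z = e at *
  generalize ⟪h, y - x⟫ = d at *
  have hcross : (e + d) ^ 2 = (1 + q⁻¹) * e ^ 2 + (1 + q) * d ^ 2 - q⁻¹ * (e - q * d) ^ 2 := by
    field_simp; ring
  have h0 : 0 ≤ q⁻¹ * (e - q * d) ^ 2 := by positivity
  have := mul_le_mul_of_nonneg_left hin (by linarith : 0 ≤ 1 + q)
  linarith

/-- The total squared distance from one member of a family to the others, in terms of the
spread. -/
theorem sum_norm_sub_sq_le_spread {n m : ℕ} (v : Fin n → Euc m) (c : Euc m) (i : Fin n) :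
    ∑ j, ‖v i - v j‖ ^ 2 ≤ 4 * n * ∑ j, ‖v j - c‖ ^ 2 := by
  have hn : (1 : ℝ) ≤ n := by exact_mod_cast i.pos
  have hpt : ∀ j, ‖v i - v j‖ ^ 2 ≤ 2 * ‖v i - c‖ ^ 2 + 2 * ‖v j - c‖ ^ 2 := by
    intro j
    have heq : v i - v j = (v i - c) - (v j - c) := by abel
    rw [heq]
    nlinarith [norm_sub_le (v i - c) (v j - c), norm_nonneg ((v i - c) - (v j - c)),
      sq_nonneg (‖v i - c‖ - ‖v j - c‖)]
  have hi : ‖v i - c‖ ^ 2 ≤ ∑ j, ‖v j - c‖ ^ 2 :=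
    Finset.single_le_sum (f := fun j => ‖v j - c‖ ^ 2) (fun j _ => sq_nonneg _)
      (Finset.mem_univ i)
  have hsum := Finset.sum_le_sum fun j (_ : j ∈ Finset.univ) => hpt j
  rw [Finset.sum_add_distrib, Finset.sum_const, ← Finset.mul_sum, Finset.card_univ,
    Fintype.card_fin, nsmul_eq_mul] at hsum
  have hP : 0 ≤ ∑ j, ‖v j - c‖ ^ 2 := Finset.sum_nonneg fun j _ => sq_nonneg _
  nlinarith [mul_le_mul_of_nonneg_left hi (by linarith : (0 : ℝ) ≤ n)]

theorem sum_norm_sub_avg_le {n m : ℕ} (v : Fin n → Euc m) :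
    ∑ i, ‖v i - (n : ℝ)⁻¹ • ∑ k, v k‖ ≤ 2 * ∑ i, ‖v i‖ := by
  have hpt : ∀ i, ‖v i - (n : ℝ)⁻¹ • ∑ k, v k‖ ≤ ‖v i‖ + (n : ℝ)⁻¹ * ∑ k, ‖v k‖ := by
    intro i
    refine (norm_sub_le _ _).trans (add_le_add le_rfl ?_)
    rw [norm_smul, Real.norm_of_nonneg (by positivity)]
    exact mul_le_mul_of_nonneg_left (norm_sum_le _ _) (by positivity)
  have hsum := Finset.sum_le_sum fun i (_ : i ∈ Finset.univ) => hpt i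
  rw [Finset.sum_add_distrib, Finset.sum_const, Finset.card_univ, Fintype.card_fin,
    nsmul_eq_mul, ← mul_assoc] at hsum
  have hB : 0 ≤ ∑ k, ‖v k‖ := Finset.sum_nonneg fun k _ => norm_nonneg _
  nlinarith [mul_inv_le_one (a := (n : ℝ)), mul_le_mul_of_nonneg_right
    (mul_inv_le_one (a := (n : ℝ))) hB]

/-- Assembling the regret bound from the cumulative residuals `E`, `Es` of the iterates and the
comparator and the cumulative spread `S`, in terms of `q = T ^ (1 / 4)`. -/
theorem regret_le_of_cumulative_bounds {q α n E Es S D R C₁ C₂ Q θs : ℝ} (hq : 1 ≤ q) (hα : 0 < α)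
    (hn : 0 ≤ n) (hD : 0 ≤ D) (hC₁ : 0 ≤ C₁) (hC₂ : 0 ≤ C₂)
    (hR : R = (α / 2) * D + (1 / (2 * α)) * (C₁ + C₂))
    (hS0 : 0 ≤ S) (hdiff : E - Es ≤ α * q ^ 3 * D + E / q ^ 3)
    (hE : α * E ≤ C₁ * q ^ 3 + C₂ * q ^ 4) (hEs : Es ≤ n * q ^ 4 * θs ^ 2) (hS : S ≤ Q) :
    (1 + q⁻¹) * (1 / 2 * E) + (1 + q) * (1 / 2 * (α * (4 * n * S))) - 1 / 2 * Es
      ≤ (1 / 2 * n * θs ^ 2 + 2 * (R + 6 * α * n * Q)) * q ^ 3 := by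
  have hq0 : 0 < q := by linarith
  have hq3 : q ≤ q ^ 3 := le_self_pow₀ hq (by norm_num)
  have hq3' : 1 ≤ q ^ 3 := one_le_pow₀ hq
  have hR0 : 0 ≤ R := by rw [hR]; positivity
  have hE' : E / q ^ 3 ≤ (C₁ + C₂ * q) / α := by
    rw [div_le_div_iff₀ (by positivity) hα]
    linarith
  have hCq : (C₁ + C₂ * q) / α ≤ (C₁ + C₂) / α * q ^ 3 := by
    rw [div_mul_eq_mul_div]
    gcongr
    nlinarith [mul_le_mul_of_nonneg_left hq3 hC₂, mul_le_mul_of_nonneg_left hq3' hC₁]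
  have hhalf : 1 / 2 * (E - Es) ≤ R * q ^ 3 := by
    have : R * q ^ 3 = 1 / 2 * (α * q ^ 3 * D + (C₁ + C₂) / α * q ^ 3) := by
      rw [hR]; field_simp
    linarith
  have hqi : q⁻¹ ≤ 1 := inv_le_one_of_one_le₀ hq
  have hqi0 : 0 < q⁻¹ := inv_pos.2 hq0
  have h1 : (1 + q⁻¹) * (1 / 2 * (E - Es)) ≤ 2 * (R * q ^ 3) :=
    (mul_le_mul_of_nonneg_left hhalf (by positivity)).trans
      (mul_le_mul_of_nonneg_right (by linarith) (by positivity))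
  have h2 : q⁻¹ * (1 / 2 * Es) ≤ 1 / 2 * n * θs ^ 2 * q ^ 3 := by
    refine (mul_le_mul_of_nonneg_left
      (mul_le_mul_of_nonneg_left hEs (by norm_num : (0 : ℝ) ≤ 1 / 2)) hqi0.le).trans_eq ?_
    field_simp
  have h3 : (1 + q) * (1 / 2 * (α * (4 * n * S))) ≤ 12 * α * n * Q * q ^ 3 := by
    have hnQ : α * n * S ≤ α * n * Q := mul_le_mul_of_nonneg_left hS (by positivity)
    have hnS : 0 ≤ α * n * S := by positivity
    have h1q : 1 + q ≤ 2 * q ^ 3 := by linarith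
    have ha := mul_le_mul_of_nonneg_right h1q hnS
    have hb := mul_le_mul_of_nonneg_left hnQ (by positivity : 0 ≤ q ^ 3)
    nlinarith
  linarith

/-- The cumulative spread is bounded by the initial spread and the cumulative gradients. -/
theorem cumulative_spread_le {σ α η q n A B C₁ C₂ C₃ C₄ C₅ E P S : ℝ} (hσ0 : 0 ≤ σ) (hσ : σ < 1)
    (hα : 0 < α) (hq : 1 ≤ q) (hn : 1 ≤ n) (hη : η = 1 / (α * q ^ 3))
    (hA : 0 ≤ A) (hAB : A ≤ 2 * B) (hPA : P ≤ A ^ 2) (hC₁ : 0 ≤ C₁) (hC₂ : 0 ≤ C₂)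
    (hC₃ : C₃ = A + √n * (σ / (1 - σ)) * B)
    (hC₄ : C₄ = n * (σ / (α * (1 - σ))) * √C₁) (hC₅ : C₅ = n * (σ / (α * (1 - σ))) * √C₂)
    (hE : α * E ≤ C₁ * q ^ 3 + C₂ * q ^ 4)
    (hS : (1 - σ) * S ≤ P + σ ^ 2 / (1 - σ) * (η ^ 2 * (α * E))) :
    S ≤ C₃ ^ 2 + C₄ ^ 2 + C₅ ^ 2 := by
  have h1 : 0 < 1 - σ := by linarith
  have hq0 : 0 < q := by linarith
  set s := σ / (1 - σ) with hs
  have hs0 : 0 ≤ s := by positivity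
  have hsqrt : 1 ≤ √n := Real.one_le_sqrt.2 hn
  have hB : 0 ≤ B := by linarith
  have hsB : s * B ≤ √n * s * B := by
    rw [mul_assoc]; exact le_mul_of_one_le_left (by positivity) hsqrt
  have hinit : P / (1 - σ) ≤ C₃ ^ 2 := by
    have heq : A ^ 2 / (1 - σ) = A ^ 2 + s * A * A := by rw [hs]; field_simp; ring
    have hle : P / (1 - σ) ≤ A ^ 2 / (1 - σ) := by gcongr
    have hbase : A ^ 2 + s * A * A ≤ (A + s * B) ^ 2 := by
      nlinarith [mul_le_mul_of_nonneg_left hAB (mul_nonneg hs0 hA), sq_nonneg (s * B)]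
    have hmono : (A + s * B) ^ 2 ≤ C₃ ^ 2 := by
      rw [hC₃]; exact pow_le_pow_left₀ (by positivity) (by linarith) 2
    linarith
  have hC45 : (s / α) ^ 2 * (C₁ + C₂) ≤ C₄ ^ 2 + C₅ ^ 2 := by
    have heq : C₄ ^ 2 + C₅ ^ 2 = n ^ 2 * ((s / α) ^ 2 * (C₁ + C₂)) := by
      rw [hC₄, hC₅, mul_pow, mul_pow _ (√C₂), Real.sq_sqrt hC₁, Real.sq_sqrt hC₂, hs]
      field_simp
    rw [heq]
    exact le_mul_of_one_le_left (by positivity) (one_le_pow₀ hn)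
  have hgrad : η ^ 2 * (α * E) ≤ (C₁ + C₂) / α ^ 2 := by
    have hle : α * E ≤ (C₁ + C₂) * q ^ 6 := by
      have h36 : q ^ 3 ≤ q ^ 6 := pow_le_pow_right₀ hq (by norm_num)
      have h46 : q ^ 4 ≤ q ^ 6 := pow_le_pow_right₀ hq (by norm_num)
      nlinarith [mul_le_mul_of_nonneg_left h36 hC₁, mul_le_mul_of_nonneg_left h46 hC₂]
    refine (mul_le_mul_of_nonneg_left hle (sq_nonneg η)).trans_eq ?_
    rw [hη]; field_simp
  have hS' : S ≤ P / (1 - σ) + s ^ 2 * (η ^ 2 * (α * E)) := by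
    have heq : P / (1 - σ) + s ^ 2 * (η ^ 2 * (α * E))
        = (P + σ ^ 2 / (1 - σ) * (η ^ 2 * (α * E))) / (1 - σ) := by
      rw [hs]; field_simp
    rw [heq, le_div_iff₀ h1]
    linarith
  have hlast : s ^ 2 * (η ^ 2 * (α * E)) ≤ (s / α) ^ 2 * (C₁ + C₂) := by
    refine (mul_le_mul_of_nonneg_left hgrad (sq_nonneg s)).trans_eq ?_
    field_simp
  linarith

/-- Theorem 1. Regret bound `O(T^{3/4})` for DOLR-FIF with `β = 3/4`. -/
theorem dolr_fif_regret_bound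
    {n m T : ℕ} (hn : 1 ≤ n) (hm : 1 ≤ m) (hT : 2 ≤ T)
    (W : Matrix (Fin n) (Fin n) ℝ) (hW : DoublyStochastic W)
    (σ : ℝ) (hσdef : σ = matOpNorm (W - avgMatrix n)) (hσ : σ < 1)
    (h : Fin n → ℕ → Euc m) (z : Fin n → ℕ → ℝ)
    (α : ℝ) (hα : 0 < α)
    (hh : ∀ i, ∀ t ∈ Finset.Icc 1 T, ‖h i t‖ ^ 2 ≤ α)
    (ystar : Euc m)
    (hmin : ∀ y : Euc m, ∑ t ∈ Finset.Icc 1 T, ∑ j, sqLoss (h j t) (z j t) ystar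
      ≤ ∑ t ∈ Finset.Icc 1 T, ∑ j, sqLoss (h j t) (z j t) y)
    (θs : ℝ) (hθs : 0 < θs)
    (hys : ∀ i, ∀ t ∈ Finset.Icc 1 T, |⟪h i t, ystar⟫ - z i t| ≤ θs)
    (x : Fin n → ℕ → Euc m)
    (hrec : ∀ i, ∀ t ∈ Finset.Icc 1 T, x i (t + 1) =
      ∑ j, W i j • (x j t - (1 / (α * (T : ℝ) ^ ((3 : ℝ) / 4))) •
        sqLossGrad (h j t) (z j t) (x j t)))
    (C₁ C₂ C₃ C₄ C₅ C₆ : ℝ)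
    (hC₁ : C₁ = ((2 : ℝ) ^ ((3 : ℝ) / 4) / ((2 : ℝ) ^ ((3 : ℝ) / 4) - 1)) * α ^ 2
      * ∑ i, ‖x i 1 - ystar‖ ^ 2)
    (hC₂ : C₂ = ((2 : ℝ) ^ ((3 : ℝ) / 4) / ((2 : ℝ) ^ ((3 : ℝ) / 4) - 1)) * α * n * θs ^ 2)
    (hC₃ : C₃ = (∑ i, ‖x i 1 - (n : ℝ)⁻¹ • ∑ k, x k 1‖)
      + Real.sqrt n * (σ / (1 - σ)) * ∑ i, ‖x i 1‖)
    (hC₄ : C₄ = n * (σ / (α * (1 - σ))) * Real.sqrt C₁)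
    (hC₅ : C₅ = n * (σ / (α * (1 - σ))) * Real.sqrt C₂)
    (hC₆ : C₆ = (α / 2) * (∑ i, ‖x i 1 - ystar‖ ^ 2) + (1 / (2 * α)) * (C₁ + C₂)
      + 6 * α * n * (C₃ ^ 2 + C₄ ^ 2 + C₅ ^ 2))
    (i : Fin n) :
    (∑ t ∈ Finset.Icc 1 T, ∑ j, sqLoss (h j t) (z j t) (x i t))
      - (∑ t ∈ Finset.Icc 1 T, ∑ j, sqLoss (h j t) (z j t) ystar)
      ≤ ((1 / 2) * n * θs ^ 2 + 2 * C₆) * (T : ℝ) ^ ((3 : ℝ) / 4) := by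
  have hn' : (1 : ℝ) ≤ n := by exact_mod_cast hn
  have hT' : (2 : ℝ) ≤ T := by exact_mod_cast hT
  have hσ0 : 0 ≤ σ := by rw [hσdef]; exact norm_nonneg _
  obtain ⟨q, hq, hqT, hq3⟩ : ∃ q : ℝ, 1 ≤ q ∧ (T : ℝ) = q ^ 4 ∧
      (T : ℝ) ^ ((3 : ℝ) / 4) = q ^ 3 := by
    refine ⟨(T : ℝ) ^ ((1 : ℝ) / 4), Real.one_le_rpow (by linarith) (by norm_num), ?_, ?_⟩ <;>
    · rw [← Real.rpow_natCast, ← Real.rpow_mul (by positivity)]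
      norm_num
  have hq0 : 0 < q := by linarith
  set p : ℝ := (2 : ℝ) ^ ((3 : ℝ) / 4) with hp
  have hp1 : 1 < p := Real.one_lt_rpow (by norm_num) (by norm_num)
  have hpq : p ≤ q ^ 3 := by
    rw [← hq3]; exact Real.rpow_le_rpow (by norm_num) hT' (by norm_num)
  rw [hq3] at hrec ⊢
  set η : ℝ := 1 / (α * q ^ 3) with hη
  have hη0 : 0 < η := by positivity
  have hηα : η * α = 1 / q ^ 3 := by rw [hη]; field_simp
  set e : Fin n → ℕ → ℝ := fun j t => ⟪h j t, x j t⟫ - z j t with he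
  set es : Fin n → ℕ → ℝ := fun j t => ⟪h j t, ystar⟫ - z j t with hes
  set E : ℝ := ∑ t ∈ Finset.Icc 1 T, ∑ j, e j t ^ 2 with hEdef
  set Es : ℝ := ∑ t ∈ Finset.Icc 1 T, ∑ j, es j t ^ 2 with hEsdef
  set D : ℝ := ∑ i, ‖x i 1 - ystar‖ ^ 2 with hDdef
  have hD0 : 0 ≤ D := Finset.sum_nonneg fun _ _ => sq_nonneg _
  have hp1' : 0 < p - 1 := by linarith
  have hC₁0 : 0 ≤ C₁ := by rw [hC₁]; positivity
  have hC₂0 : 0 ≤ C₂ := by rw [hC₂]; positivity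
  have hdiff : E - Es ≤ α * q ^ 3 * D + E / q ^ 3 := by
    have hstep : ∀ t ∈ Finset.Icc 1 T,
        (∑ j, ‖x j (t + 1) - ystar‖ ^ 2)
          + (η * (∑ j, e j t ^ 2 - ∑ j, es j t ^ 2) - η ^ 2 * (α * ∑ j, e j t ^ 2))
          ≤ ∑ j, ‖x j t - ystar‖ ^ 2 := by
      intro t ht
      have hmix := hW.sum_norm_sub_sq_le
        (fun j => x j t - η • sqLossGrad (h j t) (z j t) (x j t)) ystar
      simp only [← hrec _ t ht] at hmix
      have hgrad : ∀ j, ‖x j t - η • sqLossGrad (h j t) (z j t) (x j t) - ystar‖ ^ 2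
          ≤ ‖x j t - ystar‖ ^ 2 - η * (e j t ^ 2 - es j t ^ 2) + η ^ 2 * (α * e j t ^ 2) := by
        intro j
        have hcore := norm_sub_smul_sqLossGrad_sub_sq_le (x := x j t) (y := ystar) (z := z j t)
          (η := η) (hh j t ht)
        have hsq : 0 ≤ η * (e j t - es j t) ^ 2 := by positivity
        simp only [he, hes] at hsq ⊢
        linarith
      have hsum := hmix.trans (Finset.sum_le_sum fun j _ => hgrad j)
      simp only [Finset.sum_add_distrib, Finset.sum_sub_distrib, ← Finset.mul_sum] at hsum
      linarith
    have htel := sum_Icc_le_of_add_le (a := fun t => ∑ j, ‖x j t - ystar‖ ^ 2)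
      (fun t => Finset.sum_nonneg fun _ _ => sq_nonneg _) hstep
    simp only [Finset.sum_sub_distrib, ← Finset.mul_sum] at htel
    rw [← hEdef, ← hEsdef, ← hDdef] at htel
    have hmul := mul_le_mul_of_nonneg_left htel (by positivity : 0 ≤ α * q ^ 3)
    have heq : α * q ^ 3 * (η * (E - Es) - η ^ 2 * (α * E)) = (E - Es) - E / q ^ 3 := by
      rw [hη]; field_simp
    linarith
  have hEs : Es ≤ n * q ^ 4 * θs ^ 2 := by
    have hpt : ∀ t ∈ Finset.Icc 1 T, ∑ j, es j t ^ 2 ≤ n * θs ^ 2 := by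
      intro t ht
      refine (Finset.sum_le_card_nsmul _ _ (θs ^ 2) fun j _ => ?_).trans_eq (by simp)
      rw [← sq_abs]
      exact pow_le_pow_left₀ (abs_nonneg _) (hys j t ht) 2
    refine (Finset.sum_le_card_nsmul _ _ _ hpt).trans_eq ?_
    rw [Nat.card_Icc, nsmul_eq_mul, Nat.add_sub_cancel, hqT]
    ring
  have hE : α * E ≤ C₁ * q ^ 3 + C₂ * q ^ 4 := by
    have hE0 : 0 ≤ E := Finset.sum_nonneg fun _ _ => Finset.sum_nonneg fun _ _ => sq_nonneg _
    have hdiv : E / q ^ 3 ≤ E / p := by gcongr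
    have hle : E - E / p ≤ α * q ^ 3 * D + n * q ^ 4 * θs ^ 2 := by linarith
    have hmul := mul_le_mul_of_nonneg_left hle (by positivity : 0 ≤ p / (p - 1) * α)
    have heq : p / (p - 1) * α * (E - E / p) = α * E := by field_simp
    rw [heq] at hmul
    rw [hC₁, hC₂]
    linarith
  set avg : ℕ → Euc m := fun t => (n : ℝ)⁻¹ • ∑ k, x k t with havg
  set S : ℝ := ∑ t ∈ Finset.Icc 1 T, ∑ j, ‖x j t - avg t‖ ^ 2 with hSdef
  have hS : (1 - σ) * S ≤ ∑ j, ‖x j 1 - avg 1‖ ^ 2 + σ ^ 2 / (1 - σ) * (η ^ 2 * (α * E)) := by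
    have h1 : 0 < 1 - σ := by linarith
    have hstep : ∀ t ∈ Finset.Icc 1 T,
        (∑ j, ‖x j (t + 1) - avg (t + 1)‖ ^ 2)
          + ((1 - σ) * (∑ j, ‖x j t - avg t‖ ^ 2)
            - σ ^ 2 / (1 - σ) * (η ^ 2 * (α * ∑ j, e j t ^ 2)))
          ≤ ∑ j, ‖x j t - avg t‖ ^ 2 := by
      intro t ht
      have hmix := hW.sum_norm_sub_avg_sq_le (by omega)
        (fun j => x j t - η • sqLossGrad (h j t) (z j t) (x j t)) (avg t)
      simp only [← hrec _ t ht, ← hσdef] at hmix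
      rw [Finset.mul_sum] at hmix
      have hpt : ∀ j, σ ^ 2 * ‖x j t - η • sqLossGrad (h j t) (z j t) (x j t) - avg t‖ ^ 2
          ≤ σ * ‖x j t - avg t‖ ^ 2 + σ ^ 2 / (1 - σ) * (η ^ 2 * (α * e j t ^ 2)) := by
        intro j
        rw [sub_right_comm]
        refine (sq_mul_norm_sub_sq_le hσ0 hσ _ _).trans (add_le_add le_rfl ?_)
        rw [norm_smul, mul_pow, Real.norm_eq_abs, sq_abs]
        have := norm_sqLossGrad_sq_le (x := x j t) (z := z j t) (hh j t ht)
        gcongr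
      have hsum := hmix.trans (Finset.sum_le_sum fun j _ => hpt j)
      simp only [Finset.sum_add_distrib, ← Finset.mul_sum] at hsum
      simp only [havg] at hsum ⊢
      linarith
    have htel := sum_Icc_le_of_add_le (a := fun t => ∑ j, ‖x j t - avg t‖ ^ 2)
      (fun t => Finset.sum_nonneg fun _ _ => sq_nonneg _) hstep
    simp only [Finset.sum_sub_distrib, ← Finset.mul_sum] at htel
    rw [← hEdef, ← hSdef] at htel
    linarith
  have hA : ∀ j, 0 ≤ ‖x j 1 - avg 1‖ := fun j => norm_nonneg _
  have hSQ : S ≤ C₃ ^ 2 + C₄ ^ 2 + C₅ ^ 2 :=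
    cumulative_spread_le hσ0 hσ hα hq hn' hη (Finset.sum_nonneg fun j _ => hA j)
      (sum_norm_sub_avg_le fun j => x j 1)
      (Finset.sum_sq_le_sq_sum_of_nonneg fun j _ => hA j) hC₁0 hC₂0 hC₃ hC₄ hC₅ hE hS
  have hS0 : 0 ≤ S := Finset.sum_nonneg fun _ _ => Finset.sum_nonneg fun _ _ => sq_nonneg _
  have hloss : ∑ t ∈ Finset.Icc 1 T, ∑ j, sqLoss (h j t) (z j t) (x i t)
      ≤ (1 + q⁻¹) * (1 / 2 * E) + (1 + q) * (1 / 2 * (α * (4 * n * S))) := by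
    simp only [hEdef, hSdef, Finset.mul_sum (s := Finset.Icc 1 T), ← Finset.sum_add_distrib]
    refine Finset.sum_le_sum fun t ht => ?_
    refine (Finset.sum_le_sum fun j _ => sqLoss_le_add (x := x j t) (hh j t ht) hq0).trans ?_
    simp only [Finset.sum_add_distrib, ← Finset.mul_sum]
    have := sum_norm_sub_sq_le_spread (fun j => x j t) (avg t) i
    gcongr
  have hstar : ∑ t ∈ Finset.Icc 1 T, ∑ j, sqLoss (h j t) (z j t) ystar = 1 / 2 * Es := by
    simp only [sqLoss, hEsdef, hes, Finset.mul_sum]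
  rw [hstar, hC₆]
  have hfinal := regret_le_of_cumulative_bounds hq hα (by linarith : (0 : ℝ) ≤ n) hD0 hC₁0 hC₂0
    rfl hS0 hdiff hE hEs hSQ
  linarith
end
end

section
/- Fix n, m, s ≥ 1, T ≥ 1, a doubly stochastic matrix W ∈ ℝ^{n×n} with nonnegative entries and σ := ‖W − (1/n)𝟏𝟏ᵀ‖ < 1, constraint vectors k_1,…,k_s ∈ ℝ^m with ‖k_q‖ ≤ K_I, the polytope K = {y ∈ ℝ^m : k_qᵀy ≤ 0, q = 1,…,s} contained in the ball B_R, and data satisfying ‖h_i(t)‖² ≤ α_h and |z_i(t)| ≤ α_z for all i, t. Run DOLR-FIFC with arbitrary step size η > 0 and regularization π > 0 from x_i(1) ∈ K, μ_i(1) = 0 ∈ ℝ^s: l_i(t) = x_i(t) − η·(h_i(t)(h_i(t)ᵀx_i(t) − z_i(t)) + ∑_{q=1}^s [μ_i(t)]_q·d_q(x_i(t))), where d_q(x) = k_q if k_qᵀx > 0 and d_q(x) = 0 otherwise; x_i(t+1) = P_{B_R}(∑_j W_{ij} l_j(t)), with P_{B_R}(v) = v if ‖v‖ ≤ R and P_{B_R}(v)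 = R·v/‖v‖ otherwise; [μ_i(t+1)]_q = max{k_qᵀx_i(t+1), 0}/π. Then the cumulative disagreement satisfies ∑_{t=1}^T ∑_{i=1}^n ‖x_i(t) − x̄(t)‖ ≤ C₃ + nLE·ηT + K_I·E·∑_{t=1}^{T−1} ∑_{i=1}^n ∑_{q=1}^s η·[μ_i(t)]_q, where L = α_h R + √(α_h)·α_z, E = 3√n/(1−σ) + 4, C₃ = ∑_i ‖x_i(1) − x̄(1)‖ + √n·(σ/(1−σ))·∑_i ‖x_i(1)‖, and x̄(t) = (1/n)∑_i x_i(t). -/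
open MeasureTheory ProbabilityTheory Finset
open scoped RealInnerProductSpace Pointwise

noncomputable section

/-- Euclidean projection onto the closed ball of radius `R` centered at the origin:
`v` if `‖v‖ ≤ R`, and `R·v/‖v‖` otherwise. -/
def projBall {m : ℕ} (R : ℝ) (v : Euc m) : Euc m := if ‖v‖ ≤ R then v else (R / ‖v‖) • v

/-- The subgradient `d_q(x)` of `y ↦ [k_qᵀy]₊` at `x`: equal to `k_q` if `k_qᵀx > 0`
and to `0` otherwise. -/
def hingeGrad {m : ℕ} (k x : Euc m) : Euc m := if 0 < ⟪k, x⟫ then k else 0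

/-- A perturbed geometric recursion started at zero has total mass at most that of the
perturbations, up to the factor `1 - σ`. -/
lemma sum_le_of_contracting_recursion {σ : ℝ} {D ε : ℕ → ℝ} (hD1 : D 1 = 0) (N : ℕ)
    (hrec : ∀ t ∈ Finset.Icc 1 N, D (t + 1) ≤ σ * D t + ε t) :
    (1 - σ) * ∑ t ∈ Finset.Icc 1 (N + 1), D t + σ * D (N + 1) ≤ ∑ t ∈ Finset.Icc 1 N, ε t := by
  induction N with
  | zero => simp [hD1]
  | succ N ih =>
    have ih := ih fun t ht => hrec t (by grind)
    have hlast := hrec (N + 1) (by simp)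
    rw [Finset.sum_Icc_succ_top (by lia) D, Finset.sum_Icc_succ_top (by lia) ε]
    nlinarith

lemma norm_projBall_le {m : ℕ} {R : ℝ} (hR : 0 ≤ R) (u : Euc m) : ‖projBall R u‖ ≤ R := by
  unfold projBall
  split_ifs with hu
  · exact hu
  · have hu' : 0 < ‖u‖ := hR.trans_lt (not_le.mp hu)
    rw [norm_smul, Real.norm_of_nonneg (by positivity), div_mul_cancel₀ _ hu'.ne']

/-- Projecting onto the ball does not increase the distance to points of the ball. -/
lemma norm_projBall_sub_le {m : ℕ} {R : ℝ} (hR : 0 ≤ R) (u : Euc m) {v : Euc m} (hv : ‖v‖ ≤ R) :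
    ‖projBall R u - v‖ ≤ ‖u - v‖ := by
  unfold projBall
  split_ifs with hu
  · exact le_rfl
  · push Not at hu
    have hu' : 0 < ‖u‖ := hR.trans_lt hu
    set c := R / ‖u‖ with hc
    have hcu : c * ‖u‖ = R := div_mul_cancel₀ _ hu'.ne'
    have hc1 : c ≤ 1 := (div_le_one hu').mpr hu.le
    have hin : ⟪u, v⟫ ≤ ‖u‖ * R :=
      (real_inner_le_norm u v).trans (mul_le_mul_of_nonneg_left hv hu'.le)
    refine le_of_sq_le_sq ?_ (norm_nonneg _)
    rw [norm_sub_sq_real, norm_sub_sq_real, norm_smul, real_inner_smul_left, Real.norm_of_nonneg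
      (by positivity)]
    have key : 0 ≤ (1 - c) * ((1 + c) * ‖u‖ ^ 2 - 2 * ⟪u, v⟫) := by
      apply mul_nonneg (by linarith)
      have : (c * ‖u‖) * ‖u‖ ≤ ‖u‖ * ‖u‖ := by
        rw [hcu]; exact mul_le_mul_of_nonneg_right hu.le hu'.le
      nlinarith
    nlinarith

lemma norm_sqLossGrad_le {m : ℕ} {h x : Euc m} {z αh αz R : ℝ} (hh : ‖h‖ ^ 2 ≤ αh)
    (hz : |z| ≤ αz) (hx : ‖x‖ ≤ R) : ‖sqLossGrad h z x‖ ≤ αh * R + √αh * αz := by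
  have hh' : ‖h‖ ≤ √αh := Real.le_sqrt_of_sq_le hh
  have hin : |⟪h, x⟫| ≤ ‖h‖ * ‖x‖ := abs_real_inner_le_norm h x
  have habs : |⟪h, x⟫ - z| ≤ ‖h‖ * ‖x‖ + |z| := (abs_sub _ _).trans (by gcongr)
  calc ‖sqLossGrad h z x‖ = |⟪h, x⟫ - z| * ‖h‖ := by rw [sqLossGrad, norm_smul, Real.norm_eq_abs]
    _ ≤ (‖h‖ * ‖x‖ + |z|) * ‖h‖ := by gcongr
    _ = ‖h‖ ^ 2 * ‖x‖ + ‖h‖ * |z| := by ring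
    _ ≤ αh * R + √αh * αz := by
      have := (sq_nonneg ‖h‖).trans hh
      gcongr

lemma norm_hingeGrad_le {m : ℕ} (k x : Euc m) : ‖hingeGrad k x‖ ≤ ‖k‖ := by
  unfold hingeGrad
  split_ifs <;> simp

/-- The deviation of a family of vectors from its mean, as a vector of the `ℓ²` sum. -/
def deviation {n m : ℕ} (X : Fin n → Euc m) : PiLp 2 fun _ : Fin n => Euc m :=
  WithLp.toLp 2 fun i => X i - (n : ℝ)⁻¹ • ∑ l, X l

lemma norm_toLp_le_sum {n m : ℕ} (Y : Fin n → Euc m) : ‖WithLp.toLp 2 Y‖ ≤ ∑ i, ‖Y i‖ := by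
  rw [PiLp.norm_eq_of_L2]
  refine Real.sqrt_le_iff.mpr ⟨by positivity, ?_⟩
  exact Finset.sum_sq_le_sq_sum_of_nonneg fun i _ => norm_nonneg (Y i)

lemma sum_norm_le_sqrt_mul_norm {n m : ℕ} (Y : PiLp 2 fun _ : Fin n => Euc m) :
    ∑ i, ‖Y i‖ ≤ √n * ‖Y‖ := by
  rw [PiLp.norm_eq_of_L2, ← Real.sqrt_mul (by positivity)]
  refine Real.le_sqrt_of_sq_le ?_
  simpa using sq_sum_le_card_mul_sum_sq (s := Finset.univ) (f := fun i => ‖Y i‖)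

/-- The operator norm bounds the action of a matrix on families of vectors. -/
lemma norm_toLp_matrix_smul_le {n m : ℕ} (M : Matrix (Fin n) (Fin n) ℝ)
    (Y : PiLp 2 fun _ : Fin n => Euc m) :
    ‖(WithLp.toLp 2 fun i => ∑ j, M i j • Y j : PiLp 2 fun _ : Fin n => Euc m)‖
      ≤ matOpNorm M * ‖Y‖ := by
  have hM : 0 ≤ matOpNorm M := norm_nonneg _
  refine le_of_sq_le_sq ?_ (by positivity)
  rw [mul_pow, PiLp.norm_sq_eq_of_L2, PiLp.norm_sq_eq_of_L2]
  simp_rw [EuclideanSpace.real_norm_sq_eq]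
  rw [Finset.sum_comm, Finset.sum_comm (s := (Finset.univ : Finset (Fin n)))
    (t := (Finset.univ : Finset (Fin m))), Finset.mul_sum]
  refine Finset.sum_le_sum fun c _ => ?_
  have hop := (LinearMap.toContinuousLinearMap (Matrix.toEuclideanLin M)).le_opNorm
    (WithLp.toLp 2 fun j => Y j c)
  have hsq := pow_le_pow_left₀ (norm_nonneg _) hop 2
  rw [mul_pow, EuclideanSpace.real_norm_sq_eq, EuclideanSpace.real_norm_sq_eq] at hsq
  simpa [matOpNorm, Matrix.toLpLin_apply, Matrix.mulVec, dotProduct] using hsq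

lemma deviation_add {n m : ℕ} (X E : Fin n → Euc m) :
    deviation (fun i => X i + E i) = deviation X + deviation E := by
  ext1 i
  simp only [deviation, PiLp.add_apply, Finset.sum_add_distrib, smul_add]
  abel

lemma norm_deviation_le {n m : ℕ} (E : Fin n → Euc m) : ‖deviation E‖ ≤ 2 * ∑ i, ‖E i‖ := by
  calc ‖deviation E‖ ≤ ∑ i, ‖E i - (n : ℝ)⁻¹ • ∑ l, E l‖ := norm_toLp_le_sum _
    _ ≤ ∑ i : Fin n, (‖E i‖ + (n : ℝ)⁻¹ * ∑ l, ‖E l‖) := by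
      refine Finset.sum_le_sum fun i _ => (norm_sub_le _ _).trans ?_
      rw [norm_smul, Real.norm_of_nonneg (by positivity)]
      gcongr
      exact norm_sum_le _ _
    _ ≤ 2 * ∑ i, ‖E i‖ := by
      rcases Nat.eq_zero_or_pos n with rfl | hn
      · simp
      · rw [Finset.sum_add_distrib]
        simp only [Finset.sum_const, Finset.card_univ, Fintype.card_fin, nsmul_eq_mul]
        rw [mul_inv_cancel_left₀ (by positivity)]
        linarith

/-- Mixing with a doubly stochastic matrix contracts the deviation from the mean. -/
lemma norm_deviation_mix_le {n m : ℕ} (hn : 1 ≤ n) {W : Matrix (Fin n) (Fin n) ℝ}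
    (hW : DoublyStochastic W) (X : Fin n → Euc m) :
    ‖deviation fun i => ∑ j, W i j • X j‖ ≤ matOpNorm (W - avgMatrix n) * ‖deviation X‖ := by
  have hn0 : (n : ℝ) ≠ 0 := by positivity
  have hmean : ∑ i, ∑ j, W i j • X j = ∑ j, X j := by
    rw [Finset.sum_comm]
    simp_rw [← Finset.sum_smul, hW.2.2, one_smul]
  have hdev : ∑ j, deviation X j = 0 := by
    simp [deviation, ← Nat.cast_smul_eq_nsmul ℝ, smul_smul, hn0]
  refine le_of_eq_of_le (congrArg norm ?_)
    (norm_toLp_matrix_smul_le (W - avgMatrix n) (deviation X))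
  ext1 i
  simp only [Matrix.sub_apply, sub_smul, Finset.sum_sub_distrib, avgMatrix, Matrix.of_apply]
  rw [← Finset.smul_sum, hdev]
  simp only [deviation, hmean, smul_sub, Finset.sum_sub_distrib, ← Finset.sum_smul, hW.2.1,
    one_smul, smul_zero, sub_zero]

lemma norm_mix_le {n m : ℕ} {W : Matrix (Fin n) (Fin n) ℝ} (hW : DoublyStochastic W)
    (X : Fin n → Euc m) (i : Fin n) : ‖∑ j, W i j • X j‖ ≤ ∑ j, W i j * ‖X j‖ := by
  refine (norm_sum_le _ _).trans_eq ?_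
  simp_rw [norm_smul, Real.norm_of_nonneg (hW.1 _ _)]

/-- One step of mixing a gradient step and projecting onto the ball. -/
lemma norm_deviation_projBall_mix_le {n m : ℕ} (hn : 1 ≤ n) {W : Matrix (Fin n) (Fin n) ℝ}
    (hW : DoublyStochastic W) {R η : ℝ} (hR : 0 ≤ R) (hη : 0 ≤ η) {X G : Fin n → Euc m}
    (hX : ∀ i, ‖X i‖ ≤ R) :
    ‖deviation fun i => projBall R (∑ j, W i j • (X j - η • G j))‖
      ≤ matOpNorm (W - avgMatrix n) * ‖deviation X‖ + 2 * (η * ∑ j, ‖G j‖) := by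
  have hmix (i : Fin n) : ‖∑ j, W i j • X j‖ ≤ R := by
    calc ‖∑ j, W i j • X j‖ ≤ ∑ j, W i j * ‖X j‖ := norm_mix_le hW X i
      _ ≤ ∑ j, W i j * R := Finset.sum_le_sum fun j _ =>
        mul_le_mul_of_nonneg_left (hX j) (hW.1 i j)
      _ = R := by rw [← Finset.sum_mul, hW.2.1, one_mul]
  set e : Fin n → Euc m := fun i =>
    projBall R (∑ j, W i j • (X j - η • G j)) - ∑ j, W i j • X j with he
  have hei (i : Fin n) : ‖e i‖ ≤ η * ∑ j, W i j * ‖G j‖ := by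
    refine (norm_projBall_sub_le hR _ (hmix i)).trans ?_
    have hdiff : ∑ j, W i j • (X j - η • G j) - ∑ j, W i j • X j
        = -(η • ∑ j, W i j • G j) := by
      simp only [smul_sub, Finset.sum_sub_distrib, Finset.smul_sum, smul_comm η]
      abel
    rw [hdiff, norm_neg, norm_smul, Real.norm_of_nonneg hη]
    exact mul_le_mul_of_nonneg_left (norm_mix_le hW G i) hη
  have hesum : ∑ i, ‖e i‖ ≤ η * ∑ j, ‖G j‖ := by
    refine (Finset.sum_le_sum fun i _ => hei i).trans_eq ?_
    rw [← Finset.mul_sum, Finset.sum_comm]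
    simp_rw [← Finset.sum_mul, hW.2.2, one_mul]
  have hsplit : (fun i => projBall R (∑ j, W i j • (X j - η • G j)))
      = fun i => ∑ j, W i j • X j + e i := by
    funext i
    simp [he]
  rw [hsplit, deviation_add]
  refine (norm_add_le _ _).trans (add_le_add (norm_deviation_mix_le hn hW X) ?_)
  exact (norm_deviation_le e).trans (by gcongr)

/-- A polyhedral cone contained in a ball is trivial. -/
lemma eq_zero_of_cone_subset_closedBall {s m : ℕ} {k : Fin s → Euc m} {R : ℝ}
    (hKR : {y : Euc m | ∀ q, ⟪k q, y⟫ ≤ 0} ⊆ Metric.closedBall (0 : Euc m) R)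
    {y : Euc m} (hy : ∀ q, ⟪k q, y⟫ ≤ 0) : y = 0 := by
  by_contra hne
  have hpos : 0 < ‖y‖ := norm_pos_iff.mpr hne
  have hc : (0 : ℝ) ≤ (|R| + 1) / ‖y‖ := by positivity
  have hmem := @hKR (((|R| + 1) / ‖y‖) • y) fun q => by
    rw [real_inner_smul_right]
    exact mul_nonpos_of_nonneg_of_nonpos hc (hy q)
  rw [mem_closedBall_zero_iff, norm_smul, Real.norm_of_nonneg hc,
    div_mul_cancel₀ _ hpos.ne'] at hmem
  linarith [le_abs_self R]

/-- Lemma 4(i). Cumulative disagreement bound for DOLR-FIFC. -/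
theorem dolr_fifc_disagreement_bound
    {n m s T : ℕ} (hn : 1 ≤ n) (hm : 1 ≤ m) (hs : 1 ≤ s) (hT : 1 ≤ T)
    (W : Matrix (Fin n) (Fin n) ℝ) (hW : DoublyStochastic W)
    (σ : ℝ) (hσdef : σ = matOpNorm (W - avgMatrix n)) (hσ : σ < 1)
    (k : Fin s → Euc m) (KI : ℝ) (hk : ∀ q, ‖k q‖ ≤ KI)
    (R : ℝ)
    (hKR : {y : Euc m | ∀ q, ⟪k q, y⟫ ≤ 0} ⊆ Metric.closedBall (0 : Euc m) R)
    (h : Fin n → ℕ → Euc m) (z : Fin n → ℕ → ℝ) (αh αz : ℝ)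
    (hh : ∀ i, ∀ t ∈ Finset.Icc 1 T, ‖h i t‖ ^ 2 ≤ αh)
    (hz : ∀ i, ∀ t ∈ Finset.Icc 1 T, |z i t| ≤ αz)
    (η : ℝ) (hη : 0 < η) (π : ℝ) (hπ : 0 < π)
    (x : Fin n → ℕ → Euc m) (lam : Fin n → ℕ → Fin s → ℝ)
    (hx1 : ∀ i, ∀ q, ⟪k q, x i 1⟫ ≤ 0)
    (hlam1 : ∀ i q, lam i 1 q = 0)
    (hxrec : ∀ i, ∀ t ∈ Finset.Icc 1 T, x i (t + 1) =
      projBall R (∑ j, W i j • (x j t - η • (sqLossGrad (h j t) (z j t) (x j t)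
        + ∑ q, lam j t q • hingeGrad (k q) (x j t)))))
    (hlamrec : ∀ i, ∀ t ∈ Finset.Icc 1 T, ∀ q,
      lam i (t + 1) q = max ⟪k q, x i (t + 1)⟫ 0 / π)
    (L Ec C₃ : ℝ)
    (hL : L = αh * R + Real.sqrt αh * αz)
    (hEc : Ec = 3 * Real.sqrt n / (1 - σ) + 4)
    (hC₃ : C₃ = (∑ i, ‖x i 1 - (n : ℝ)⁻¹ • ∑ l, x l 1‖)
      + Real.sqrt n * (σ / (1 - σ)) * ∑ i, ‖x i 1‖) :
    ∑ t ∈ Finset.Icc 1 T, ∑ i, ‖x i t - (n : ℝ)⁻¹ • ∑ l, x l t‖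
      ≤ C₃ + n * L * Ec * (η * T)
        + KI * Ec * ∑ t ∈ Finset.Icc 1 (T - 1), ∑ i, ∑ q, η * lam i t q := by
  have hR : 0 ≤ R := by
    simpa using @hKR 0 (fun q => by simp)
  have hσ0 : 0 ≤ σ := hσdef ▸ norm_nonneg _
  have hKI : 0 ≤ KI := (norm_nonneg _).trans (hk ⟨0, hs⟩)
  have h1T : 1 ∈ Finset.Icc 1 T := by simp [hT]
  have hαh : 0 ≤ αh := (sq_nonneg _).trans (hh ⟨0, hn⟩ 1 h1T)
  have hαz : 0 ≤ αz := (abs_nonneg _).trans (hz ⟨0, hn⟩ 1 h1T)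
  have hL0 : 0 ≤ L := hL ▸ by positivity
  have hx0 (i : Fin n) : x i 1 = 0 := eq_zero_of_cone_subset_closedBall hKR (hx1 i)
  have hC : C₃ = 0 := by simp [hC₃, hx0]
  have hcases (t : ℕ) (ht : t ∈ Finset.Icc 1 T) :
      t = 1 ∨ ∃ u ∈ Finset.Icc 1 T, t = u + 1 := by
    obtain ⟨h1, h2⟩ := Finset.mem_Icc.mp ht
    rcases h1.eq_or_lt with h1 | h1
    · exact .inl h1.symm
    · exact .inr ⟨t - 1, Finset.mem_Icc.mpr (by lia), by lia⟩
  have hxR (i : Fin n) (t : ℕ) (ht : t ∈ Finset.Icc 1 T) : ‖x i t‖ ≤ R := by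
    obtain rfl | ⟨u, hu, rfl⟩ := hcases t ht
    · simpa [hx0] using hR
    · rw [hxrec i u hu]
      exact norm_projBall_le hR _
  have hlam0 (i : Fin n) (t : ℕ) (ht : t ∈ Finset.Icc 1 T) (q : Fin s) : 0 ≤ lam i t q := by
    obtain rfl | ⟨u, hu, rfl⟩ := hcases t ht
    · rw [hlam1]
    · rw [hlamrec i u hu]
      positivity
  set S : ℝ := ∑ t ∈ Finset.Icc 1 (T - 1), ∑ i, ∑ q, η * lam i t q with hS
  have hTsub : Finset.Icc 1 (T - 1) ⊆ Finset.Icc 1 T := Finset.Icc_subset_Icc_right (by lia)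
  have hS0 : 0 ≤ S := Finset.sum_nonneg fun t ht => Finset.sum_nonneg fun i _ =>
    Finset.sum_nonneg fun q _ => mul_nonneg hη.le (hlam0 i t (hTsub ht) q)
  set D : ℕ → ℝ := fun t => ‖deviation fun i => x i t‖ with hD
  set ε : ℕ → ℝ := fun t => 2 * (n * L * η + KI * ∑ i, ∑ q, η * lam i t q) with hε
  have hD1 : D 1 = 0 := by
    simp [hD, deviation, hx0, ← Pi.zero_def]
  have hgrad (j : Fin n) (t : ℕ) (ht : t ∈ Finset.Icc 1 T) :
      ‖sqLossGrad (h j t) (z j t) (x j t) + ∑ q, lam j t q • hingeGrad (k q) (x j t)‖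
        ≤ L + KI * ∑ q, lam j t q := by
    refine (norm_add_le _ _).trans (add_le_add ?_ ?_)
    · exact hL ▸ norm_sqLossGrad_le (hh j t ht) (hz j t ht) (hxR j t ht)
    · rw [Finset.mul_sum]
      refine norm_sum_le_of_le _ fun q _ => ?_
      rw [norm_smul, Real.norm_of_nonneg (hlam0 j t ht q), mul_comm]
      exact mul_le_mul_of_nonneg_right ((norm_hingeGrad_le _ _).trans (hk q)) (hlam0 j t ht q)
  have hrec (t : ℕ) (ht : t ∈ Finset.Icc 1 (T - 1)) : D (t + 1) ≤ σ * D t + ε t := by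
    have ht' := hTsub ht
    have hstep := norm_deviation_projBall_mix_le hn hW hR hη.le (fun i => hxR i t ht')
      (G := fun j => sqLossGrad (h j t) (z j t) (x j t)
        + ∑ q, lam j t q • hingeGrad (k q) (x j t))
    simp only [hD, hxrec _ t ht']
    rw [hσdef]
    refine hstep.trans (add_le_add le_rfl ?_)
    have hsum := Finset.sum_le_sum fun j (_ : j ∈ Finset.univ) => hgrad j t ht'
    calc _ ≤ 2 * (η * ∑ j, (L + KI * ∑ q, lam j t q)) := by gcongr
      _ = ε t := by
        simp only [hε, Finset.sum_add_distrib, ← Finset.mul_sum, Finset.sum_const,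
          Finset.card_univ, Fintype.card_fin, nsmul_eq_mul]
        ring
  have htotal := sum_le_of_contracting_recursion hD1 (T - 1) hrec
  rw [Nat.sub_add_cancel hT] at htotal
  have hDT : 0 ≤ σ * D T := mul_nonneg hσ0 (norm_nonneg _)
  have hεsum : ∑ t ∈ Finset.Icc 1 (T - 1), ε t ≤ 2 * (n * L * (η * T) + KI * S) := by
    simp only [hε, hS, ← Finset.mul_sum, Finset.sum_add_distrib, Finset.sum_const, Nat.card_Icc,
      nsmul_eq_mul, Nat.add_sub_cancel]
    have hcast : ((T - 1 : ℕ) : ℝ) ≤ T := by exact_mod_cast Nat.sub_le T 1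
    have : ((T - 1 : ℕ) : ℝ) * (n * L * η) ≤ T * (n * L * η) := by gcongr
    linarith
  set A : ℝ := n * L * (η * T) + KI * S with hA
  have hA0 : 0 ≤ A := by positivity
  have h1σ : 0 < 1 - σ := sub_pos.mpr hσ
  have hDsum : ∑ t ∈ Finset.Icc 1 T, D t ≤ 2 * A / (1 - σ) := by
    rw [le_div_iff₀ h1σ]
    linarith
  calc ∑ t ∈ Finset.Icc 1 T, ∑ i, ‖x i t - (n : ℝ)⁻¹ • ∑ l, x l t‖
      ≤ ∑ t ∈ Finset.Icc 1 T, √n * D t :=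
        Finset.sum_le_sum fun t _ => sum_norm_le_sqrt_mul_norm (deviation fun i => x i t)
    _ = √n * ∑ t ∈ Finset.Icc 1 T, D t := by rw [Finset.mul_sum]
    _ ≤ √n * (2 * A / (1 - σ)) := by gcongr
    _ = 2 * √n / (1 - σ) * A := by ring
    _ ≤ Ec * A := by
      gcongr
      rw [hEc]
      have : 2 * √n / (1 - σ) ≤ 3 * √n / (1 - σ) := by
        gcongr
        norm_num
      linarith
    _ = _ := by rw [hC, hA]; ring
end
end

section
/- Fix n, m ≥ 1, T ≥ 2, a doubly stochastic matrix W ∈ ℝ^{n×n} with nonnegative entries and σ := ‖W − (1/n)𝟏𝟏ᵀ‖ < 1, and data h_i(t) ∈ ℝ^m, z_i(t) ∈ ℝ with ‖h_i(t)‖² ≤ α (α > 0) for all i, t. Assume the exact solution set S* = {y ∈ ℝ^m : h_i(t)ᵀy = z_i(t) for all i ∈ {1,…,n}, t ∈ {1,…,T}} is nonempty. Run DOLR-FIF with β = 1/2: x_i(t+1) = ∑_j W_{ij}·(x_j(t) − (1/(α√T))·h_j(t)(h_j(t)ᵀx_j(t) − z_j(t))). Let p be the orthogonal projection of x̄(1)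 = (1/n)∑_i x_i(1) onto the (nonempty closed affine) set S*, and set D = ∑_{i=1}^n ‖x_i(1) − p‖². Then for every node i: ∑_{t=1}^T ∑_{j=1}^n θ_{j,t}(x_i(t)) ≤ (C̄₁/α + 8αnC₃²) + (αD + 8αnC̄₄²)·√T, where C̄₁ = (√2/(√2 − 1))·α²·D, C̄₄ = n·(σ/(α(1−σ)))·√C̄₁, and C₃ = ∑_i ‖x_i(1) − x̄(1)‖ + √n·(σ/(1−σ))·∑_i ‖x_i(1)‖. -/
open MeasureTheory ProbabilityTheory Finset
open scoped RealInnerProductSpace Pointwise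

noncomputable section

lemma matOpNorm_nonneg {n : ℕ} (M : Matrix (Fin n) (Fin n) ℝ) : 0 ≤ matOpNorm M :=
  norm_nonneg _

lemma sum_sq_mulVec_le {n : ℕ} (M : Matrix (Fin n) (Fin n) ℝ) (v : Fin n → ℝ) :
    ∑ i, (∑ j, M i j * v j) ^ 2 ≤ matOpNorm M ^ 2 * ∑ j, v j ^ 2 := by
  have hle := (LinearMap.toContinuousLinearMap (Matrix.toEuclideanLin M)).le_opNorm
    (WithLp.toLp 2 v)
  have hsq := pow_le_pow_left₀ (norm_nonneg _) hle 2
  rw [mul_pow, EuclideanSpace.real_norm_sq_eq, EuclideanSpace.real_norm_sq_eq] at hsq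
  simpa [matOpNorm, Matrix.toLpLin_apply, Matrix.mulVec, dotProduct] using hsq

/-- A matrix acting blockwise on vectors of `ℝ^m` keeps its operator norm. -/
lemma sum_norm_sq_sum_smul_le {n m : ℕ} (M : Matrix (Fin n) (Fin n) ℝ) (v : Fin n → Euc m) :
    ∑ i, ‖∑ j, M i j • v j‖ ^ 2 ≤ matOpNorm M ^ 2 * ∑ j, ‖v j‖ ^ 2 := by
  simp_rw [EuclideanSpace.real_norm_sq_eq]
  rw [Finset.sum_comm, Finset.sum_comm (f := fun j k => (v j) k ^ 2), Finset.mul_sum]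
  refine Finset.sum_le_sum fun k _ => ?_
  simpa using sum_sq_mulVec_le M fun j => v j k

lemma DoublyStochastic.sum_norm_sq_le {n m : ℕ} {W : Matrix (Fin n) (Fin n) ℝ}
    (hW : DoublyStochastic W) (v : Fin n → Euc m) :
    ∑ i, ‖∑ j, W i j • v j‖ ^ 2 ≤ ∑ j, ‖v j‖ ^ 2 := by
  have hconv : ConvexOn ℝ Set.univ fun y : Euc m => ‖y‖ ^ 2 :=
    (convexOn_norm convex_univ).pow (fun _ _ => norm_nonneg _) 2
  calc ∑ i, ‖∑ j, W i j • v j‖ ^ 2 ≤ ∑ i, ∑ j, W i j * ‖v j‖ ^ 2 :=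
        Finset.sum_le_sum fun i _ => by
          simpa using hconv.map_sum_le (t := Finset.univ) (w := W i) (p := v)
            (fun j _ => hW.1 i j) (hW.2.1 i) (fun _ _ => Set.mem_univ _)
    _ = ∑ j, ‖v j‖ ^ 2 := by
        rw [Finset.sum_comm]
        exact Finset.sum_congr rfl fun j _ => by rw [← Finset.sum_mul, hW.2.2 j, one_mul]

lemma DoublyStochastic.sum_smul_sub {n m : ℕ} {W : Matrix (Fin n) (Fin n) ℝ}
    (hW : DoublyStochastic W) (v : Fin n → Euc m) (c : Euc m) (i : Fin n) :
    ∑ j, W i j • (v j - c) = ∑ j, W i j • v j - c := by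
  simp_rw [smul_sub, Finset.sum_sub_distrib, ← Finset.sum_smul, hW.2.1 i, one_smul]

/-- The deviation from the mean after one mixing step, for any choice of origin `c`. -/
lemma DoublyStochastic.sum_smul_sub_mean {n m : ℕ} (hn : 1 ≤ n) {W : Matrix (Fin n) (Fin n) ℝ}
    (hW : DoublyStochastic W) (v : Fin n → Euc m) (c : Euc m) (i : Fin n) :
    ∑ j, W i j • v j - (n : ℝ)⁻¹ • ∑ l, ∑ j, W l j • v j
      = ∑ j, (W - avgMatrix n) i j • (v j - c) := by
  have hn0 : (n : ℝ) ≠ 0 := by positivity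
  have hcol : ∑ l, ∑ j, W l j • v j = ∑ j, v j := by
    rw [Finset.sum_comm]
    exact Finset.sum_congr rfl fun j _ => by rw [← Finset.sum_smul, hW.2.2 j, one_smul]
  have havg : ∑ j, (n : ℝ)⁻¹ • (v j - c) = (n : ℝ)⁻¹ • ∑ j, v j - c := by
    rw [← Finset.smul_sum, Finset.sum_sub_distrib, smul_sub]
    simp [← Nat.cast_smul_eq_nsmul ℝ, smul_smul, hn0]
  simp only [Matrix.sub_apply, avgMatrix, Matrix.of_apply, sub_smul, Finset.sum_sub_distrib]
  rw [hW.sum_smul_sub, havg, hcol]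
  abel

lemma sum_Icc_le_of_le_sub {a b : ℕ → ℝ} {T : ℕ}
    (hab : ∀ t ∈ Finset.Icc 1 T, a (t + 1) ≤ a t - b t) :
    ∑ t ∈ Finset.Icc 1 T, b t ≤ a 1 - a (T + 1) := by
  induction T with
  | zero => simp
  | succ T ih =>
    rw [Finset.sum_Icc_succ_top (by omega)]
    have h₁ := ih fun t ht => hab t (by simp at ht ⊢; omega)
    have h₂ := hab (T + 1) (by simp)
    linarith

/-- Young's inequality with the weights for which the contraction factor `σ²` becomes `σ`. -/
lemma mul_norm_sub_sq_le {m : ℕ} {σ : ℝ} (h0 : 0 ≤ σ) (h1 : σ < 1) (a b : Euc m) :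
    σ ^ 2 * ‖a - b‖ ^ 2 ≤ σ * ‖a‖ ^ 2 + σ ^ 2 / (1 - σ) * ‖b‖ ^ 2 := by
  have hs : 0 < 1 - σ := by linarith
  have hsq : 0 ≤ ‖(1 - σ) • a + σ • b‖ ^ 2 := by positivity
  rw [norm_add_sq_real, norm_smul, norm_smul, real_inner_smul_left, real_inner_smul_right,
    mul_pow, mul_pow, Real.norm_eq_abs, Real.norm_eq_abs, sq_abs, sq_abs] at hsq
  have key : σ * ‖a‖ ^ 2 + σ ^ 2 / (1 - σ) * ‖b‖ ^ 2 - σ ^ 2 * ‖a - b‖ ^ 2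
      = σ / (1 - σ) * ((1 - σ) ^ 2 * ‖a‖ ^ 2 + 2 * ((1 - σ) * (σ * ⟪a, b⟫))
        + σ ^ 2 * ‖b‖ ^ 2) := by
    rw [norm_sub_sq_real]
    field_simp
    ring
  have := mul_nonneg (div_nonneg h0 hs.le) hsq
  linarith

lemma norm_sub_smul_smul_sq_le {m : ℕ} {α η : ℝ} (hη : 0 ≤ η) (hηα : η * α ≤ 1) {g : Euc m}
    (hg : ‖g‖ ^ 2 ≤ α) (e : Euc m) :
    ‖e - η • (⟪g, e⟫ • g)‖ ^ 2 ≤ ‖e‖ ^ 2 - η * ⟪g, e⟫ ^ 2 := by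
  rw [norm_sub_sq_real, norm_smul, norm_smul, real_inner_smul_right, real_inner_smul_right,
    real_inner_comm g e, mul_pow, mul_pow, Real.norm_eq_abs, Real.norm_eq_abs, sq_abs, sq_abs]
  have h₁ : η * ‖g‖ ^ 2 ≤ 1 := (mul_le_mul_of_nonneg_left hg hη).trans hηα
  have h₂ := mul_le_mul_of_nonneg_left h₁ (mul_nonneg hη (sq_nonneg ⟪g, e⟫))
  nlinarith

lemma sqLoss_le_of_inner_eq {m : ℕ} {α ζ : ℝ} {g p : Euc m} (hg : ‖g‖ ^ 2 ≤ α)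
    (hp : ⟪g, p⟫ = ζ) (a b c : Euc m) :
    sqLoss g ζ a ≤ ⟪g, b - p⟫ ^ 2 + α * (2 * ‖a - c‖ ^ 2 + 2 * ‖b - c‖ ^ 2) := by
  have hab : ⟪g, a - b⟫ ^ 2 ≤ α * (2 * ‖a - c‖ ^ 2 + 2 * ‖b - c‖ ^ 2) := by
    have h₁ : ⟪g, a - b⟫ ^ 2 ≤ (‖g‖ * ‖a - b‖) ^ 2 := by
      rw [← sq_abs]
      exact pow_le_pow_left₀ (abs_nonneg _) (abs_real_inner_le_norm _ _) 2
    have h₂ : ‖a - b‖ ^ 2 ≤ 2 * ‖a - c‖ ^ 2 + 2 * ‖b - c‖ ^ 2 := by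
      have h₃ := parallelogram_law_with_norm ℝ (a - c) (b - c)
      rw [sub_sub_sub_cancel_right] at h₃
      nlinarith [mul_self_nonneg ‖a - c + (b - c)‖]
    rw [mul_pow] at h₁
    exact h₁.trans (mul_le_mul hg h₂ (by positivity) ((sq_nonneg _).trans hg))
  have hsplit : ⟪g, a⟫ - ζ = ⟪g, b - p⟫ + ⟪g, a - b⟫ := by
    rw [← hp, inner_sub_right, inner_sub_right]
    ring
  rw [sqLoss, hsplit]
  nlinarith [sq_nonneg (⟪g, b - p⟫ - ⟪g, a - b⟫)]

/-- The variance of a finite family, over the spectral gap, against the transient constant. -/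
lemma sum_norm_sub_mean_sq_div_le {n m : ℕ} (hn : 1 ≤ n) {σ : ℝ} (h0 : 0 ≤ σ) (h1 : σ < 1)
    (v : Fin n → Euc m) :
    (∑ j, ‖v j - (n : ℝ)⁻¹ • ∑ l, v l‖ ^ 2) / (1 - σ)
      ≤ (∑ j, ‖v j - (n : ℝ)⁻¹ • ∑ l, v l‖ + √n * (σ / (1 - σ)) * ∑ j, ‖v j‖) ^ 2 := by
  have hs : 0 < 1 - σ := by linarith
  have hn0 : (n : ℝ) ≠ 0 := by positivity
  set c : Euc m := (n : ℝ)⁻¹ • ∑ l, v l with hc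
  set V := ∑ j, ‖v j - c‖ ^ 2
  set A := ∑ j, ‖v j - c‖
  set B := ∑ j, ‖v j‖
  have hV : 0 ≤ V := by positivity
  have hA : 0 ≤ A := by positivity
  have hB : 0 ≤ B := by positivity
  have hVA : V ≤ A ^ 2 := Finset.sum_sq_le_sq_sum_of_nonneg fun j _ => norm_nonneg _
  have hVB : V ≤ B ^ 2 := by
    have hsum : ∑ j, v j = (n : ℝ) • c := by rw [hc, smul_inv_smul₀ hn0]
    have hexp : V = ∑ j, ‖v j‖ ^ 2 - n * ‖c‖ ^ 2 := by
      simp only [V, norm_sub_sq_real, Finset.sum_add_distrib, Finset.sum_sub_distrib,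
        ← Finset.mul_sum, ← sum_inner, hsum, real_inner_smul_left, real_inner_self_eq_norm_sq]
      simp
      ring
    have : ∑ j, ‖v j‖ ^ 2 ≤ B ^ 2 := Finset.sum_sq_le_sq_sum_of_nonneg fun j _ => norm_nonneg _
    have : 0 ≤ n * ‖c‖ ^ 2 := by positivity
    linarith
  have hVAB : V ≤ A * B := by
    refine (sq_le_sq₀ hV (mul_nonneg hA hB)).1 ?_
    rw [mul_pow, sq V]
    exact mul_le_mul hVA hVB hV (sq_nonneg _)
  have hq : 0 ≤ σ / (1 - σ) := div_nonneg h0 hs.le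
  have hsqrt : 1 ≤ √(n : ℝ) := Real.one_le_sqrt.2 (by exact_mod_cast hn)
  have hsplit : V / (1 - σ) = V + σ / (1 - σ) * V := by field_simp; ring
  have h₁ : σ / (1 - σ) * V ≤ √n * (σ / (1 - σ)) * (A * B) :=
    mul_le_mul (le_mul_of_one_le_left hq hsqrt) hVAB hV (by positivity)
  have h₂ : 0 ≤ √n * (σ / (1 - σ)) * (A * B) := by positivity
  rw [hsplit]
  nlinarith [sq_nonneg (√n * (σ / (1 - σ)) * B)]

/-- Theorem 6. `O(√T)` regret for DOLR-FIF with `β = 1/2` when the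
network-wide linear regression admits an exact solution. -/
theorem dolr_fif_exact_regret_bound
    {n m T : ℕ} (hn : 1 ≤ n) (hm : 1 ≤ m) (hT : 2 ≤ T)
    (W : Matrix (Fin n) (Fin n) ℝ) (hW : DoublyStochastic W)
    (σ : ℝ) (hσdef : σ = matOpNorm (W - avgMatrix n)) (hσ : σ < 1)
    (h : Fin n → ℕ → Euc m) (z : Fin n → ℕ → ℝ)
    (α : ℝ) (hα : 0 < α)
    (hh : ∀ i, ∀ t ∈ Finset.Icc 1 T, ‖h i t‖ ^ 2 ≤ α)
    (hS : {y : Euc m | ∀ i, ∀ t ∈ Finset.Icc 1 T, ⟪h i t, y⟫ = z i t}.Nonempty)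
    (x : Fin n → ℕ → Euc m)
    (hrec : ∀ i, ∀ t ∈ Finset.Icc 1 T, x i (t + 1) =
      ∑ j, W i j • (x j t - (1 / (α * Real.sqrt T)) •
        sqLossGrad (h j t) (z j t) (x j t)))
    (p : Euc m)
    (hpS : p ∈ {y : Euc m | ∀ i, ∀ t ∈ Finset.Icc 1 T, ⟪h i t, y⟫ = z i t})
    (hpproj : ∀ y ∈ {y : Euc m | ∀ i, ∀ t ∈ Finset.Icc 1 T, ⟪h i t, y⟫ = z i t},
      dist ((n : ℝ)⁻¹ • ∑ i, x i 1) p ≤ dist ((n : ℝ)⁻¹ • ∑ i, x i 1) y)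
    (D C₁bar C₃ C₄bar : ℝ)
    (hD : D = ∑ i, ‖x i 1 - p‖ ^ 2)
    (hC₁bar : C₁bar = (Real.sqrt 2 / (Real.sqrt 2 - 1)) * α ^ 2 * D)
    (hC₃ : C₃ = (∑ i, ‖x i 1 - (n : ℝ)⁻¹ • ∑ l, x l 1‖)
      + Real.sqrt n * (σ / (1 - σ)) * ∑ i, ‖x i 1‖)
    (hC₄bar : C₄bar = n * (σ / (α * (1 - σ))) * Real.sqrt C₁bar)
    (i : Fin n) :
    ∑ t ∈ Finset.Icc 1 T, ∑ j, sqLoss (h j t) (z j t) (x i t)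
      ≤ (C₁bar / α + 8 * α * n * C₃ ^ 2)
        + (α * D + 8 * α * n * C₄bar ^ 2) * Real.sqrt T := by
  have hσ0 : 0 ≤ σ := hσdef ▸ matOpNorm_nonneg _
  have hs : 0 < 1 - σ := by linarith
  have hT1 : 1 ≤ √(T : ℝ) := Real.one_le_sqrt.2 (by exact_mod_cast (by omega : 1 ≤ T))
  have hT0 : 0 < √(T : ℝ) := by linarith
  set η : ℝ := 1 / (α * √T) with hη
  have hη0 : 0 < η := by positivity
  have hηα : η * α ≤ 1 := by
    rw [hη, one_div_mul_eq_div, div_le_one (by positivity)]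
    exact le_mul_of_one_le_right hα.le hT1
  have hD0 : 0 ≤ D := hD ▸ (by positivity)
  have hgrad : ∀ j, ∀ t ∈ Finset.Icc 1 T,
      sqLossGrad (h j t) (z j t) (x j t) = ⟪h j t, x j t - p⟫ • h j t := fun j t ht => by
    rw [sqLossGrad, inner_sub_right, hpS j t ht]
  set r : ℕ → ℝ := fun t => ∑ j, ⟪h j t, x j t - p⟫ ^ 2 with hr
  set c : ℕ → Euc m := fun t => (n : ℝ)⁻¹ • ∑ l, x l t with hc
  set V : ℕ → ℝ := fun t => ∑ j, ‖x j t - c t‖ ^ 2 with hV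
  have hV0 : ∀ t, 0 ≤ V t := fun t => by positivity
  have hdist : ∀ t ∈ Finset.Icc 1 T,
      ∑ l, ‖x l (t + 1) - p‖ ^ 2 ≤ ∑ l, ‖x l t - p‖ ^ 2 - η * r t := fun t ht => by
    simp_rw [hrec _ t ht, ← hW.sum_smul_sub]
    refine (hW.sum_norm_sq_le _).trans ?_
    rw [hr, Finset.mul_sum, ← Finset.sum_sub_distrib]
    refine Finset.sum_le_sum fun j _ => ?_
    rw [hgrad j t ht, sub_right_comm]
    exact norm_sub_smul_smul_sq_le hη0.le hηα (hh j t ht) _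
  have hvar : ∀ t ∈ Finset.Icc 1 T,
      V (t + 1) ≤ V t - ((1 - σ) * V t - σ ^ 2 / (1 - σ) * (η ^ 2 * (α * r t))) :=
    fun t ht => by
    have hstep : V (t + 1) ≤ σ ^ 2 * ∑ j, ‖x j t - c t
        - η • sqLossGrad (h j t) (z j t) (x j t)‖ ^ 2 := by
      simp_rw [hV, hc, hrec _ t ht, hW.sum_smul_sub_mean hn _ (c t), hσdef, sub_right_comm _ _ (c t)]
      exact sum_norm_sq_sum_smul_le _ _
    refine hstep.trans ?_
    rw [Finset.mul_sum]
    refine (Finset.sum_le_sum fun j _ => mul_norm_sub_sq_le hσ0 hσ _ _).trans ?_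
    rw [Finset.sum_add_distrib, ← Finset.mul_sum, ← Finset.mul_sum]
    have hg : ∑ j, ‖η • sqLossGrad (h j t) (z j t) (x j t)‖ ^ 2 ≤ η ^ 2 * (α * r t) := by
      rw [hr, Finset.mul_sum, Finset.mul_sum]
      refine Finset.sum_le_sum fun j _ => ?_
      rw [hgrad j t ht, norm_smul, norm_smul, mul_pow, mul_pow, Real.norm_eq_abs,
        Real.norm_eq_abs, sq_abs, sq_abs, mul_comm α]
      gcongr
      exact hh j t ht
    have := mul_le_mul_of_nonneg_left hg (div_nonneg (sq_nonneg σ) hs.le)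
    linarith
  set R := ∑ t ∈ Finset.Icc 1 T, r t
  set S := ∑ t ∈ Finset.Icc 1 T, V t
  have hR : η * R ≤ D := by
    have := sum_Icc_le_of_le_sub (a := fun t => ∑ l, ‖x l t - p‖ ^ 2) hdist
    rw [← Finset.mul_sum] at this
    have h0 : 0 ≤ ∑ l, ‖x l (T + 1) - p‖ ^ 2 := by positivity
    linarith
  have hS' : S ≤ C₃ ^ 2 + (σ / (1 - σ)) ^ 2 * (D * √T) := by
    have h₁ := sum_Icc_le_of_le_sub hvar
    simp only [Finset.sum_sub_distrib, ← Finset.mul_sum] at h₁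
    have h₂ : η ^ 2 * (α * R) ≤ D * √T := by
      calc η ^ 2 * (α * R) = (η * α) * (η * R) := by ring
        _ ≤ 1 * D := mul_le_mul hηα hR (by positivity) zero_le_one
        _ ≤ D * √T := by rw [one_mul]; exact le_mul_of_one_le_right hD0 hT1
    have h₃ : V 1 / (1 - σ) ≤ C₃ ^ 2 :=
      hC₃ ▸ sum_norm_sub_mean_sq_div_le hn hσ0 hσ fun j => x j 1
    have h₄ : S ≤ V 1 / (1 - σ) + (σ / (1 - σ)) ^ 2 * (η ^ 2 * (α * R)) := by
      have h₅ : V 1 / (1 - σ) + (σ / (1 - σ)) ^ 2 * (η ^ 2 * (α * R))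
          = (V 1 + σ ^ 2 / (1 - σ) * (η ^ 2 * (α * R))) / (1 - σ) := by
        field_simp
      rw [h₅, le_div_iff₀ hs]
      linarith [hV0 (T + 1)]
    have := mul_le_mul_of_nonneg_left h₂ (sq_nonneg (σ / (1 - σ)))
    linarith
  have hR' : R ≤ α * D * √T := by
    rw [hη, one_div_mul_eq_div, div_le_iff₀ (by positivity)] at hR
    linarith
  have hn1 : (1 : ℝ) ≤ n := by exact_mod_cast hn
  have hloss : ∑ t ∈ Finset.Icc 1 T, ∑ j, sqLoss (h j t) (z j t) (x i t)
      ≤ R + 4 * α * n * S := by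
    rw [Finset.mul_sum, ← Finset.sum_add_distrib]
    refine Finset.sum_le_sum fun t ht => ?_
    refine (Finset.sum_le_sum fun j _ => sqLoss_le_of_inner_eq (hh j t ht) (hpS j t ht)
      (x i t) (x j t) (c t)).trans ?_
    rw [Finset.sum_add_distrib, ← Finset.mul_sum, Finset.sum_add_distrib, ← Finset.mul_sum,
      ← Finset.mul_sum, Finset.sum_const, Finset.card_univ, Fintype.card_fin, nsmul_eq_mul]
    have hi : ‖x i t - c t‖ ^ 2 ≤ V t :=
      Finset.single_le_sum (f := fun j => ‖x j t - c t‖ ^ 2) (fun j _ => sq_nonneg _)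
        (Finset.mem_univ i)
    have h₁ : n * (2 * ‖x i t - c t‖ ^ 2) + 2 * V t ≤ 4 * n * V t := by
      nlinarith [hV0 t, mul_le_mul_of_nonneg_left hi (zero_le_one.trans hn1)]
    have := mul_le_mul_of_nonneg_left h₁ hα.le
    simp only [hV, hr] at this ⊢
    linarith
  have hK : 1 ≤ √2 / (√2 - 1) := by
    have h2 : 1 < √(2 : ℝ) := Real.lt_sqrt_of_sq_lt (by norm_num)
    rw [le_div_iff₀ (by linarith)]
    linarith
  have hC₁0 : 0 ≤ C₁bar := by rw [hC₁bar]; positivity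
  have hC₄ : (σ / (1 - σ)) ^ 2 * D ≤ C₄bar ^ 2 := by
    have h₁ : C₄bar ^ 2 = (σ / (1 - σ)) ^ 2 * D * (n ^ 2 * (√2 / (√2 - 1))) := by
      rw [hC₄bar, mul_pow, Real.sq_sqrt hC₁0, hC₁bar]
      field_simp
    rw [h₁]
    exact le_mul_of_one_le_right (by positivity) (one_le_mul_of_one_le_of_one_le
      (one_le_pow₀ hn1) hK)
  have hfin := mul_le_mul_of_nonneg_left
    (hS'.trans (add_le_add_right ((mul_assoc _ D _).symm.le.trans
      (mul_le_mul_of_nonneg_right hC₄ hT0.le)) _)) (by positivity : 0 ≤ 4 * α * n)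
  have h₁ : 0 ≤ C₁bar / α := by positivity
  have h₂ : 0 ≤ α * n * C₃ ^ 2 := by positivity
  have h₃ : 0 ≤ α * n * (C₄bar ^ 2 * √T) := by positivity
  linarith
end
end
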